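/- Let Φ ∈ 𝓕 with domain I, let (X,Z,Y) be finite-valued random variables forming a Markov chain X → Z → Y (X and Y are conditionally independent given Z), and let f be a function of (X,Y,Z) with values in I. Then H_Φ(E[f|Z]) + H_Φ(f | X,Z) ≥ H_Φ(E[f | Y,Z]). -/

import Mathlib

open Finset

/-- A probability mass function on a finite sample space. -/
def IsPMF {Ω : Type*} [Fintype Ω] (p : Ω → ℝ) : Prop :=
  (∀ ω, 0 ≤ p ω) ∧ ∑ ω, p ω = 1

/-- Expectation of `f` with respect to the mass function `p`. -/
noncomputable def pexp {Ω : Type*} [Fintype Ω] (p f : Ω → ℝ) : ℝ :=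
  ∑ ω, p ω * f ω

/-- Conditional expectation `E[f | X]`, as a random variable on `Ω`. -/
noncomputable def pcexp {Ω α : Type*} [Fintype Ω] [DecidableEq α]
    (p : Ω → ℝ) (X : Ω → α) (f : Ω → ℝ) (ω : Ω) : ℝ :=
  (∑ ω', if X ω' = X ω then p ω' * f ω' else 0) /
    (∑ ω', if X ω' = X ω then p ω' else 0)

/-- The Φ-entropy `H_Φ(f) = E[Φ(f)] - Φ(E[f])`. -/
noncomputable def entPhi {Ω : Type*} [Fintype Ω] (Φ : ℝ → ℝ) (p f : Ω → ℝ) : ℝ :=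
  pexp p (fun ω => Φ (f ω)) - Φ (pexp p f)

/-- The conditional Φ-entropy `H_Φ(f | X) = E[Φ(f)] - E[Φ(E[f|X])]`. -/
noncomputable def condEntPhi {Ω α : Type*} [Fintype Ω] [DecidableEq α]
    (Φ : ℝ → ℝ) (p : Ω → ℝ) (f : Ω → ℝ) (X : Ω → α) : ℝ :=
  pexp p (fun ω => Φ (f ω)) - pexp p (fun ω => Φ (pcexp p X f ω))

/-- The class `𝓕` of non-affine smooth convex functions `Φ` on a convex set `I ⊆ ℝ`
with `Φ'' > 0` such that `1/Φ''` is concave on `I`. -/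
structure PhiFamily where
  Φ : ℝ → ℝ
  I : Set ℝ
  convex_I : Convex ℝ I
  smooth : ContDiffOn ℝ (⊤ : ℕ∞) Φ I
  convexOn : ConvexOn ℝ I Φ
  nonaffine : ¬ ∃ c₁ c₀ : ℝ, ∀ x ∈ I, Φ x = c₁ * x + c₀
  secondDeriv_pos : ∀ x ∈ I, 0 < iteratedDerivWithin 2 Φ I x
  inv_secondDeriv_concave : ConcaveOn ℝ I (fun x => 1 / iteratedDerivWithin 2 Φ I x)

/-- The Φ-ribbon of a joint distribution `μ` on `α × β`: all pairs `(λ₁, λ₂)` with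
`λ₁ H_Φ(E[f|A]) + λ₂ H_Φ(E[f|B]) ≤ H_Φ(f)` for every `I`-valued function `f` of `(A,B)`. -/
def ribbon {α β : Type*} [Fintype α] [Fintype β] [DecidableEq α] [DecidableEq β]
    (P : PhiFamily) (μ : α × β → ℝ) : Set (ℝ × ℝ) :=
  {l : ℝ × ℝ | ∀ f : α × β → ℝ, (∀ ab, f ab ∈ P.I) →
    l.1 * entPhi P.Φ μ (pcexp μ Prod.fst f) +
      l.2 * entPhi P.Φ μ (pcexp μ Prod.snd f) ≤ entPhi P.Φ μ f}

namespace PhiFamily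

lemma uniqueDiffOn_I (P : PhiFamily) : UniqueDiffOn ℝ P.I := by
  refine uniqueDiffOn_convex P.convex_I (P.convex_I.nontrivial_iff_nonempty_interior.1 ?_)
  by_contra h
  rw [Set.not_nontrivial_iff] at h
  rcases P.I.eq_empty_or_nonempty with h0 | ⟨x₀, hx₀⟩
  · exact P.nonaffine ⟨0, 0, fun x hx => by simp [h0] at hx⟩
  · exact P.nonaffine ⟨0, P.Φ x₀, fun x hx => by rw [h hx hx₀]; ring⟩

lemma hasDerivWithinAt (P : PhiFamily) {x : ℝ} (hx : x ∈ P.I) :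
    HasDerivWithinAt P.Φ (derivWithin P.Φ P.I x) P.I x :=
  (P.smooth.differentiableOn (by simp) x hx).hasDerivWithinAt

lemma hasDerivWithinAt_derivWithin (P : PhiFamily) {x : ℝ} (hx : x ∈ P.I) :
    HasDerivWithinAt (derivWithin P.Φ P.I) (iteratedDerivWithin 2 P.Φ P.I x) P.I x := by
  have h : DifferentiableOn ℝ (derivWithin P.Φ P.I) P.I :=
    (P.smooth.derivWithin P.uniqueDiffOn_I (m := 1) (by norm_cast)).differentiableOn
      one_ne_zero
  have h2 : iteratedDerivWithin 2 P.Φ P.I x = derivWithin (derivWithin P.Φ P.I) P.I x := by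
    rw [iteratedDerivWithin_succ, iteratedDerivWithin_one]
  rw [h2]
  exact (h x hx).hasDerivWithinAt

/-- Nonnegativity of the second variation of the Φ-entropy functional. -/
lemma secondDeriv_mul_sq_le (P : PhiFamily) {ι : Type*} [Fintype ι] {q : ι → ℝ} (hq : IsPMF q)
    {w : ι → ℝ} (hw : ∀ i, w i ∈ P.I) (h : ι → ℝ) :
    iteratedDerivWithin 2 P.Φ P.I (∑ i, q i * w i) * (∑ i, q i * h i) ^ 2 ≤
      ∑ i, q i * (iteratedDerivWithin 2 P.Φ P.I (w i) * h i ^ 2) := by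
  have hmem : ∑ i, q i * w i ∈ P.I :=
    P.convex_I.sum_mem (fun i _ => hq.1 i) hq.2 fun i _ => hw i
  have hC := P.secondDeriv_pos _ hmem
  have hJ := P.inv_secondDeriv_concave.le_map_sum (t := univ) (fun i _ => hq.1 i) hq.2
    fun i _ => hw i
  simp only [smul_eq_mul] at hJ
  set C := iteratedDerivWithin 2 P.Φ P.I (∑ i, q i * w i)
  have hc := fun i => P.secondDeriv_pos _ (hw i)
  have hnn : ∀ i ∈ univ, 0 ≤ q i * (iteratedDerivWithin 2 P.Φ P.I (w i) * h i ^ 2) :=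
    fun i _ => mul_nonneg (hq.1 i) (mul_nonneg (hc i).le (sq_nonneg _))
  have hCS := sum_sq_le_sum_mul_sum_of_sq_le_mul univ (r := fun i => q i * h i) hnn
    (g := fun i => q i * (1 / iteratedDerivWithin 2 P.Φ P.I (w i)))
    (fun i _ => mul_nonneg (hq.1 i) (one_div_pos.2 (hc i)).le)
    (fun i _ => le_of_eq (by have := (hc i).ne'; field_simp))
  have hle := hCS.trans (mul_le_mul_of_nonneg_left hJ (sum_nonneg hnn))
  rwa [mul_one_div, le_div_iff₀ hC, mul_comm] at hle

/-- For a fixed finite probability vector, the Φ-entropy is convex in the function. -/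
lemma convexOn_entPhi (P : PhiFamily) {ι : Type*} [Fintype ι] {q : ι → ℝ} (hq : IsPMF q) :
    ConvexOn ℝ {f : ι → ℝ | ∀ i, f i ∈ P.I} (entPhi P.Φ q) := by
  refine ⟨fun f hf g hg s t hs ht hst i => P.convex_I (hf i) (hg i) hs ht hst, ?_⟩
  intro a ha b hb s t hs ht hst
  set L : ι → ℝ → ℝ := fun i r => a i + r * (b i - a i) with hL
  have hLmem : ∀ i, ∀ r ∈ Set.Icc (0 : ℝ) 1, L i r ∈ P.I := by
    intro i r hr
    have := P.convex_I (ha i) (hb i) (sub_nonneg.2 hr.2) hr.1 (by ring)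
    simp only [smul_eq_mul] at this
    convert this using 1
    simp only [hL]
    ring
  have hMmem : ∀ r ∈ Set.Icc (0 : ℝ) 1, ∑ i, q i * L i r ∈ P.I := fun r hr =>
    P.convex_I.sum_mem (fun i _ => hq.1 i) hq.2 fun i _ => hLmem i r hr
  have hLd : ∀ i r, HasDerivAt (L i) (b i - a i) r := fun i r => by
    simpa [hL] using ((hasDerivAt_id r).mul_const (b i - a i)).const_add (a i)
  have hMd : ∀ r, HasDerivAt (fun r => ∑ i, q i * L i r) (∑ i, q i * (b i - a i)) r := fun r =>
    HasDerivAt.fun_sum fun i _ => (hLd i r).const_mul (q i)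
  have hd1 : ∀ r ∈ Set.Icc (0 : ℝ) 1, HasDerivWithinAt
      (fun r => (∑ i, q i * P.Φ (L i r)) - P.Φ (∑ i, q i * L i r))
      ((∑ i, q i * (derivWithin P.Φ P.I (L i r) * (b i - a i))) -
        derivWithin P.Φ P.I (∑ i, q i * L i r) * ∑ i, q i * (b i - a i)) (Set.Icc 0 1) r := by
    intro r hr
    refine HasDerivWithinAt.sub (HasDerivWithinAt.fun_sum fun i _ => ?_) ?_
    · exact ((P.hasDerivWithinAt (hLmem i r hr)).comp r (hLd i r).hasDerivWithinAt
        (hLmem i)).const_mul (q i)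
    · exact (P.hasDerivWithinAt (hMmem r hr)).comp r (hMd r).hasDerivWithinAt hMmem
  have hd2 : ∀ r ∈ Set.Icc (0 : ℝ) 1, HasDerivWithinAt
      (fun r => (∑ i, q i * (derivWithin P.Φ P.I (L i r) * (b i - a i))) -
        derivWithin P.Φ P.I (∑ i, q i * L i r) * ∑ i, q i * (b i - a i))
      ((∑ i, q i * (iteratedDerivWithin 2 P.Φ P.I (L i r) * (b i - a i) * (b i - a i))) -
        iteratedDerivWithin 2 P.Φ P.I (∑ i, q i * L i r) * (∑ i, q i * (b i - a i)) *
          ∑ i, q i * (b i - a i)) (Set.Icc 0 1) r := by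
    intro r hr
    refine HasDerivWithinAt.sub (HasDerivWithinAt.fun_sum fun i _ => ?_) ?_
    · exact (((P.hasDerivWithinAt_derivWithin (hLmem i r hr)).comp r
        (hLd i r).hasDerivWithinAt (hLmem i)).mul_const _).const_mul (q i)
    · exact ((P.hasDerivWithinAt_derivWithin (hMmem r hr)).comp r
        (hMd r).hasDerivWithinAt hMmem).mul_const _
  have hconv := convexOn_of_hasDerivWithinAt2_nonneg (convex_Icc (0 : ℝ) 1)
    (fun r hr => (hd1 r hr).continuousWithinAt)
    (fun r hr => (hd1 r (interior_subset hr)).mono interior_subset)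
    (fun r hr => (hd2 r (interior_subset hr)).mono interior_subset)
    (fun r hr => by
      have := P.secondDeriv_mul_sq_le hq (fun i => hLmem i r (interior_subset hr))
        (fun i => b i - a i)
      simp only [sq, ← mul_assoc] at this ⊢
      linarith)
  have h01 := hconv.2 (Set.left_mem_Icc.2 zero_le_one) (Set.right_mem_Icc.2 zero_le_one) hs ht hst
  have hLt : ∀ i, a i + t * (b i - a i) = s * a i + t * b i := fun i => by
    rw [eq_sub_of_add_eq hst]; ring
  simpa [entPhi, pexp, hLt, hL] using h01

/-- Subadditivity of the Φ-entropy over a product distribution. -/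
lemma subadditive_prod (P : PhiFamily) {α β : Type*} [Fintype α] [Fintype β]
    {p : α → ℝ} {q : β → ℝ} (hp : IsPMF p) (hq : IsPMF q) {f : α → β → ℝ}
    (hf : ∀ x y, f x y ∈ P.I) :
    (∑ x, p x * P.Φ (∑ y, q y * f x y)) + ∑ y, q y * P.Φ (∑ x, p x * f x y) ≤
      (∑ x, ∑ y, p x * q y * P.Φ (f x y)) + P.Φ (∑ x, ∑ y, p x * q y * f x y) := by
  have h := (P.convexOn_entPhi hq).map_sum_le (t := univ) (p := f) (fun x _ => hp.1 x) hp.2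
    fun x _ => hf x
  have hswap : ∑ y, q y * ∑ x, p x * f x y = ∑ x, ∑ y, p x * q y * f x y := by
    simp only [mul_sum]
    rw [sum_comm]
    exact sum_congr rfl fun x _ => sum_congr rfl fun y _ => by ring
  simp only [entPhi, pexp, Finset.sum_apply, Pi.smul_apply, smul_eq_mul, mul_sub,
    sum_sub_distrib, hswap] at h
  simp only [mul_sum, ← mul_assoc] at h ⊢
  linarith

/-- Subadditivity of the Φ-entropy for an unnormalised mass function of product form. -/
lemma subadditive_of_mul_eq (P : PhiFamily) {α β : Type*} [Fintype α] [Fintype β]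
    {m : α → β → ℝ} (hm : ∀ x y, 0 ≤ m x y)
    (hprod : ∀ x y, m x y * (∑ x', ∑ y', m x' y') = (∑ y', m x y') * ∑ x', m x' y)
    {g : α → β → ℝ} (hg : ∀ x y, g x y ∈ P.I) :
    (∑ x, ∑ y, m x y * P.Φ ((∑ y', m x y' * g x y') / ∑ y', m x y')) +
        ∑ x, ∑ y, m x y * P.Φ ((∑ x', m x' y * g x' y) / ∑ x', m x' y) ≤
      (∑ x, ∑ y, m x y * P.Φ (g x y)) +
        ∑ x, ∑ y, m x y * P.Φ ((∑ x', ∑ y', m x' y' * g x' y') / ∑ x', ∑ y', m x' y') := by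
  set M := ∑ x, ∑ y, m x y with hM
  have hM0 : 0 ≤ M := sum_nonneg fun x _ => sum_nonneg fun y _ => hm x y
  rcases hM0.eq_or_lt with h0 | hpos
  · have hz : ∀ x y, m x y = 0 := fun x y =>
      (sum_eq_zero_iff_of_nonneg fun y _ => hm x y).1
        ((sum_eq_zero_iff_of_nonneg fun x _ => sum_nonneg fun y _ => hm x y).1
          (hM.symm.trans h0.symm) x (mem_univ x)) y (mem_univ y)
    simp [hz]
  set p : α → ℝ := fun x => (∑ y, m x y) / M with hp
  set q : β → ℝ := fun y => (∑ x, m x y) / M with hq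
  have hpP : IsPMF p := ⟨fun x => div_nonneg (sum_nonneg fun y _ => hm x y) hM0, by
    simp only [hp]; rw [← sum_div]; exact div_self hpos.ne'⟩
  have hqP : IsPMF q := ⟨fun y => div_nonneg (sum_nonneg fun x _ => hm x y) hM0, by
    simp only [hq]; rw [← sum_div, sum_comm]; exact div_self hpos.ne'⟩
  have hA : ∀ x, ∑ y, m x y = M * p x := fun x => (mul_div_cancel₀ _ hpos.ne').symm
  have hB : ∀ y, ∑ x, m x y = M * q y := fun y => (mul_div_cancel₀ _ hpos.ne').symm
  have hmpq : ∀ x y, m x y = M * (p x * q y) := fun x y => by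
    have := hprod x y
    rw [hA, hB] at this
    exact mul_right_cancel₀ hpos.ne' (by linarith)
  have hX : ∀ x, ∑ y, m x y * P.Φ ((∑ y', m x y' * g x y') / ∑ y', m x y') =
      M * (p x * P.Φ (∑ y, q y * g x y)) := fun x => by
    rw [← sum_mul, hA, mul_assoc]
    rcases eq_or_ne (p x) 0 with h | h
    · simp [h]
    have : ∑ y, m x y * g x y = M * p x * ∑ y, q y * g x y := by
      rw [mul_sum]; exact sum_congr rfl fun y _ => by rw [hmpq]; ring
    rw [this, mul_div_cancel_left₀ _ (mul_ne_zero hpos.ne' h)]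
  have hY : ∀ y, ∑ x, m x y * P.Φ ((∑ x', m x' y * g x' y) / ∑ x', m x' y) =
      M * (q y * P.Φ (∑ x, p x * g x y)) := fun y => by
    rw [← sum_mul, hB, mul_assoc]
    rcases eq_or_ne (q y) 0 with h | h
    · simp [h]
    have : ∑ x, m x y * g x y = M * q y * ∑ x, p x * g x y := by
      rw [mul_sum]; exact sum_congr rfl fun x _ => by rw [hmpq]; ring
    rw [this, mul_div_cancel_left₀ _ (mul_ne_zero hpos.ne' h)]
  have hsum : ∀ G : α → β → ℝ, ∑ x, ∑ y, m x y * G x y = M * ∑ x, ∑ y, p x * q y * G x y :=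
    fun G => by simp only [mul_sum, hmpq, mul_assoc]
  have hconst : ∀ c, ∑ x, ∑ y, m x y * c = M * c := fun c => by simp only [← sum_mul, ← hM]
  have hYsum : ∑ x, ∑ y, m x y * P.Φ ((∑ x', m x' y * g x' y) / ∑ x', m x' y) =
      M * ∑ y, q y * P.Φ (∑ x, p x * g x y) := by
    rw [sum_comm, mul_sum]; exact sum_congr rfl fun y _ => hY y
  rw [hYsum, sum_congr rfl fun x _ => hX x, hconst, hsum, hsum, mul_div_cancel_left₀ _ hpos.ne',
    ← mul_sum, ← mul_add, ← mul_add]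
  exact mul_le_mul_of_nonneg_left (P.subadditive_prod hpP hqP hg) hM0

end PhiFamily

/-- The tower property `E[E[f | X]] = E[f]`. -/
lemma pexp_pcexp {Ω α : Type*} [Fintype Ω] [DecidableEq α] {p : Ω → ℝ} (hp : ∀ ω, 0 ≤ p ω)
    (X : Ω → α) (f : Ω → ℝ) : pexp p (pcexp p X f) = pexp p f := by
  have hfib : ∀ ω ω', p ω * ((if X ω' = X ω then p ω' * f ω' else 0) /
      ∑ ω'', if X ω'' = X ω then p ω'' else 0) =
      (if X ω = X ω' then p ω else 0) *
        (p ω' * f ω' / ∑ ω'', if X ω'' = X ω' then p ω'' else 0) := by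
    intro ω ω'
    by_cases h : X ω = X ω'
    · simp [h]
    · simp [h, Ne.symm h]
  simp only [pexp, pcexp, sum_div, mul_sum, hfib]
  rw [sum_comm]
  refine sum_congr rfl fun ω' _ => ?_
  rw [← sum_mul]
  by_cases h0 : (∑ ω'', if X ω'' = X ω' then p ω'' else 0) = 0
  · have := (sum_eq_zero_iff_of_nonneg fun ω _ => by split_ifs <;> simp [hp]).1 h0 ω' (mem_univ _)
    simp only [if_true] at this
    simp [this]
  · exact mul_div_cancel₀ _ h0

/-- for `Φ ∈ 𝓕`, a Markov chain `X → Z → Y` (i.e. `X ⟂ Y | Z`) and any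
`I`-valued function `f` of `(X,Z,Y)`, we have
`H_Φ(E[f|Z]) + H_Φ(f | X,Z) ≥ H_Φ(E[f | Y,Z])`.
The sample space is `α × γ × β`, a point `ω = (x, z, y)`. -/
theorem stmt4 (P : PhiFamily)
    {α γ β : Type*} [Fintype α] [Fintype γ] [Fintype β]
    [DecidableEq α] [DecidableEq γ] [DecidableEq β]
    (μ : α × γ × β → ℝ) (hμ : IsPMF μ)
    (hMarkov : ∀ x z y, μ (x, z, y) * (∑ x', ∑ y', μ (x', z, y')) =
      (∑ y', μ (x, z, y')) * (∑ x', μ (x', z, y)))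
    (f : α × γ × β → ℝ) (hf : ∀ ω, f ω ∈ P.I) :
    entPhi P.Φ μ (pcexp μ (fun ω => ω.2.1) f) + condEntPhi P.Φ μ f (fun ω => (ω.1, ω.2.1)) ≥
      entPhi P.Φ μ (pcexp μ (fun ω => (ω.2.2, ω.2.1)) f) := by
  have hite : ∀ (z : γ) (F : γ → β → ℝ),
      (∑ z', ∑ y, if z' = z then F z' y else 0) = ∑ y, F z y := fun z F => by
    rw [sum_comm]; simp
  have hX : ∀ x z y, pcexp μ (fun ω => (ω.1, ω.2.1)) f (x, z, y) =
      (∑ y', μ (x, z, y') * f (x, z, y')) / ∑ y', μ (x, z, y') := fun x z y => by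
    simp [pcexp, Fintype.sum_prod_type, ite_and, hite]
  have hY : ∀ x z y, pcexp μ (fun ω => (ω.2.2, ω.2.1)) f (x, z, y) =
      (∑ x', μ (x', z, y) * f (x', z, y)) / ∑ x', μ (x', z, y) := fun x z y => by
    simp [pcexp, Fintype.sum_prod_type, ite_and]
  have hZ : ∀ x z y, pcexp μ (fun ω => ω.2.1) f (x, z, y) =
      (∑ x', ∑ y', μ (x', z, y') * f (x', z, y')) / ∑ x', ∑ y', μ (x', z, y') := fun x z y => by
    simp [pcexp, Fintype.sum_prod_type, hite]
  have hexp : ∀ g, pexp μ g = ∑ z, ∑ x, ∑ y, μ (x, z, y) * g (x, z, y) := fun g => by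
    simp only [pexp, Fintype.sum_prod_type]
    exact sum_comm
  have hker := sum_le_sum fun z (_ : z ∈ univ) =>
    P.subadditive_of_mul_eq (m := fun x y => μ (x, z, y)) (g := fun x y => f (x, z, y))
      (fun x y => hμ.1 _) (fun x y => hMarkov x z y) fun x y => hf _
  simp only [sum_add_distrib] at hker
  simp only [entPhi, condEntPhi, pexp_pcexp hμ.1]
  simp only [hexp, hX, hY, hZ]
  linarith
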